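/- Let R be an associative ring with unit and let X, Y be classes of right R-modules. Then: (a) id_X(L) ≤ id_X(Y) + coresdim_Y(L) for every R-module L; (b) if Y = X^{⊥1}, or Y is a subclass of X closed under direct summands, and id_X(Y) = 0, then id_X(L) = coresdim_Y(L) for every L ∈ Y^∨; (c) if Y = X^{⊥1}, then coresdim_Y(M) ≤ id_X(M) for every R-module M, and in particular coresdim_Y(Mod R) ≤ pd(X). -/

import Mathlib

noncomputable section

open CategoryTheory CategoryTheory.Limits Opposite DirectSum

universe u

namespace CotorsionDim

variable {R : Type u} [Ring R]

/-- `Ext^n_R(M,N) = 0`. -/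
def ExtZero (M N : ModuleCat.{u} R) (n : ℕ) : Prop :=
  IsZero (((Ext ℤ (ModuleCat.{u} R) n).obj (op M)).obj N)

/-- A pair of composable maps forms a short exact sequence `0 → A → B → C → 0`. -/
def IsSES {A B C : ModuleCat.{u} R} (f : A ⟶ B) (g : B ⟶ C) : Prop :=
  ∃ w : f ≫ g = 0, (CategoryTheory.ShortComplex.mk f g w).ShortExact

/-- relative projective dimension `pd_𝒳(M)` -/
def rpd (𝒳 : Set (ModuleCat.{u} R)) (M : ModuleCat.{u} R) : ℕ∞ :=
  sInf {n : ℕ∞ | ∀ j : ℕ, n < (j : ℕ∞) → ∀ X ∈ 𝒳, ExtZero M X j}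

/-- relative injective dimension `id_𝒳(M)` -/
def rid (𝒳 : Set (ModuleCat.{u} R)) (M : ModuleCat.{u} R) : ℕ∞ :=
  sInf {n : ℕ∞ | ∀ j : ℕ, n < (j : ℕ∞) → ∀ X ∈ 𝒳, ExtZero X M j}

/-- `pd_𝒳(𝒴)` -/
def rpdClass (𝒳 𝒴 : Set (ModuleCat.{u} R)) : ℕ∞ := ⨆ Y : 𝒴, rpd 𝒳 Y

/-- `id_𝒳(𝒴)` -/
def ridClass (𝒳 𝒴 : Set (ModuleCat.{u} R)) : ℕ∞ := ⨆ Y : 𝒴, rid 𝒳 Y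

/-- projective dimension -/
def pd (M : ModuleCat.{u} R) : ℕ∞ := rpd Set.univ M

/-- injective dimension -/
def idim (M : ModuleCat.{u} R) : ℕ∞ := rid Set.univ M

/-- `pd(𝒴)` -/
def pdClass (𝒴 : Set (ModuleCat.{u} R)) : ℕ∞ := ⨆ Y : 𝒴, pd Y.1

/-- `id(𝒴)` -/
def idClass (𝒴 : Set (ModuleCat.{u} R)) : ℕ∞ := ⨆ Y : 𝒴, idim Y.1

/-- `M` has an `𝒳`-resolution `0 → X_n → ⋯ → X_0 → M → 0` of length `n`. -/
def HasResLen (𝒳 : Set (ModuleCat.{u} R)) : ℕ → ModuleCat.{u} R → Prop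
  | 0, M => M ∈ 𝒳
  | n+1, M => ∃ (K X : ModuleCat.{u} R) (f : K ⟶ X) (g : X ⟶ M),
      X ∈ 𝒳 ∧ IsSES f g ∧ HasResLen 𝒳 n K

/-- `M` has an `𝒳`-coresolution `0 → M → X_0 → ⋯ → X_n → 0` of length `n`. -/
def HasCoresLen (𝒳 : Set (ModuleCat.{u} R)) : ℕ → ModuleCat.{u} R → Prop
  | 0, M => M ∈ 𝒳
  | n+1, M => ∃ (X C : ModuleCat.{u} R) (f : M ⟶ X) (g : X ⟶ C),
      X ∈ 𝒳 ∧ IsSES f g ∧ HasCoresLen 𝒳 n C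

/-- `resdim_𝒳(M)` -/
def resdim (𝒳 : Set (ModuleCat.{u} R)) (M : ModuleCat.{u} R) : ℕ∞ :=
  ⨅ n : {n : ℕ // HasResLen 𝒳 n M}, (n : ℕ∞)

/-- `coresdim_𝒳(M)` -/
def coresdim (𝒳 : Set (ModuleCat.{u} R)) (M : ModuleCat.{u} R) : ℕ∞ :=
  ⨅ n : {n : ℕ // HasCoresLen 𝒳 n M}, (n : ℕ∞)

/-- `resdim_𝒳(𝒴)` -/
def resdimClass (𝒳 𝒴 : Set (ModuleCat.{u} R)) : ℕ∞ := ⨆ Y : 𝒴, resdim 𝒳 Y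

/-- `coresdim_𝒳(𝒴)` -/
def coresdimClass (𝒳 𝒴 : Set (ModuleCat.{u} R)) : ℕ∞ := ⨆ Y : 𝒴, coresdim 𝒳 Y

/-- `𝒳^∧`, the class of modules with a finite `𝒳`-resolution. -/
def resClosure (𝒳 : Set (ModuleCat.{u} R)) : Set (ModuleCat.{u} R) :=
  {M | ∃ n, HasResLen 𝒳 n M}

/-- `𝒳^∨`, the class of modules with a finite `𝒳`-coresolution. -/
def coresClosure (𝒳 : Set (ModuleCat.{u} R)) : Set (ModuleCat.{u} R) :=
  {M | ∃ n, HasCoresLen 𝒳 n M}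

/-- `(𝒜, ℬ)` is a cotorsion pair. -/
def IsCotorsionPair (𝒜 ℬ : Set (ModuleCat.{u} R)) : Prop :=
  (∀ M, M ∈ 𝒜 ↔ ∀ B ∈ ℬ, ExtZero M B 1) ∧
  (∀ M, M ∈ ℬ ↔ ∀ A ∈ 𝒜, ExtZero A M 1)

/-- completeness of a cotorsion pair -/
def IsComplete (𝒜 ℬ : Set (ModuleCat.{u} R)) : Prop :=
  ∀ M : ModuleCat.{u} R,
    (∃ (B A : ModuleCat.{u} R) (f : B ⟶ A) (g : A ⟶ M), B ∈ ℬ ∧ A ∈ 𝒜 ∧ IsSES f g) ∧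
    (∃ (B A : ModuleCat.{u} R) (f : M ⟶ B) (g : B ⟶ A), B ∈ ℬ ∧ A ∈ 𝒜 ∧ IsSES f g)

/-- heredity of a cotorsion pair -/
def IsHereditary (𝒜 ℬ : Set (ModuleCat.{u} R)) : Prop :=
  ∀ i : ℕ, 1 ≤ i → ∀ A ∈ 𝒜, ∀ B ∈ ℬ, ExtZero A B i

variable (R)

/-- `𝒫`, the class of modules of finite projective dimension. -/
def P : Set (ModuleCat.{u} R) := {M | pd M < ⊤}

variable {R}

/-- `M` admits a projective resolution consisting of finitely generated projectives,
i.e. `M ∈ mod R`. -/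
def InmodR (M : ModuleCat.{u} R) : Prop :=
  ∃ K : ℕ → ModuleCat.{u} R, K 0 = M ∧ ∀ i : ℕ,
    ∃ (Q : ModuleCat.{u} R) (f : K (i+1) ⟶ Q) (g : Q ⟶ K i),
      Module.Finite R Q ∧ Projective Q ∧ IsSES f g

variable (R)

/-- `𝒫^{<∞} = 𝒫 ∩ mod R`. -/
def Pfin : Set (ModuleCat.{u} R) := {M | pd M < ⊤ ∧ InmodR M}

/-- the big finitistic dimension -/
def bigFindim : ℕ∞ := pdClass (P R)

/-- the little finitistic dimension -/
def littleFindim : ℕ∞ := pdClass (Pfin R)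

variable {R}

/-- `𝒳^{⊥₁}` -/
def rperp1 (𝒳 : Set (ModuleCat.{u} R)) : Set (ModuleCat.{u} R) :=
  {M | ∀ X ∈ 𝒳, ExtZero X M 1}

/-- `^{⊥₁}𝒳` -/
def lperp1 (𝒳 : Set (ModuleCat.{u} R)) : Set (ModuleCat.{u} R) :=
  {M | ∀ X ∈ 𝒳, ExtZero M X 1}

/-- `T^⊥ = {M : Ext^i(T,M) = 0 for all i > 0}` -/
def rperpAll (T : ModuleCat.{u} R) : Set (ModuleCat.{u} R) :=
  {M | ∀ i : ℕ, 0 < i → ExtZero T M i}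

/-- `Add T`: direct summands of arbitrary direct sums of copies of `T`. -/
def AddT (T : ModuleCat.{u} R) : Set (ModuleCat.{u} R) :=
  {M | ∃ (I : Type u) (s : M ⟶ ModuleCat.of R (I →₀ T)) (r : ModuleCat.of R (I →₀ T) ⟶ M),
    s ≫ r = 𝟙 M}

/-- `T` is a tilting module. -/
def IsTilting (T : ModuleCat.{u} R) : Prop :=
  pd T < ⊤ ∧
  (∀ i : ℕ, 0 < i → ∀ I : Type u, ExtZero T (ModuleCat.of R (I →₀ T)) i) ∧
  ∃ n, HasCoresLen (AddT T) n (ModuleCat.of R R)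


/-- `𝒳` is closed under arbitrary direct sums (coproducts). -/
def ClosedUnderCoproducts (𝒳 : Set (ModuleCat.{u} R)) : Prop :=
  ∀ (I : Type u) (f : I → ModuleCat.{u} R), (∀ i, f i ∈ 𝒳) →
    ModuleCat.of R (⨁ i, (f i : Type u)) ∈ 𝒳

/-- `𝒳` is closed under direct summands. -/
def ClosedUnderSummands (𝒳 : Set (ModuleCat.{u} R)) : Prop :=
  ∀ (M N : ModuleCat.{u} R) (s : M ⟶ N) (r : N ⟶ M), s ≫ r = 𝟙 M → N ∈ 𝒳 → M ∈ 𝒳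

lemma extZero_succ_iff (M N : ModuleCat.{u} R) (n : ℕ) :
    ExtZero M N (n + 1) ↔ Subsingleton (Abelian.Ext M N (n + 1)) := by
  obtain ⟨P⟩ := HasProjectiveResolution.out (Z := M)
  have hExact : ExtZero M N (n + 1) ↔
      ∀ f : P.complex.X (n + 1) ⟶ N, P.complex.d (n + 2) (n + 1) ≫ f = 0 →
        ∃ g : P.complex.X n ⟶ N, P.complex.d (n + 1) n ≫ g = f := by
    rw [ExtZero, (P.isoExt (R := ℤ) (n + 1) N).isZero_iff,
      ← HomologicalComplex.exactAt_iff_isZero_homology,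
      HomologicalComplex.exactAt_iff' _ n (n + 1) (n + 2) (by simp) (by simp),
      ShortComplex.moduleCat_exact_iff]
    rfl
  rw [hExact]
  constructor
  · refine fun h => subsingleton_of_forall_eq 0 fun α => ?_
    obtain ⟨f, hf, rfl⟩ := P.extMk_surjective α (n + 2) rfl
    exact (P.extMk_eq_zero_iff f (n + 2) rfl hf n rfl).2 (h f hf)
  · exact fun _ f hf =>
      (P.extMk_eq_zero_iff f (n + 2) rfl hf n rfl).1 (Subsingleton.elim _ _)

lemma ExtZero.of_ses_left {A B C X : ModuleCat.{u} R} {f : A ⟶ B} {g : B ⟶ C}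
    (h : IsSES f g) {n : ℕ} (hB : ExtZero X B (n + 2)) (hC : ExtZero X C (n + 1)) :
    ExtZero X A (n + 2) := by
  obtain ⟨w, hS⟩ := h
  rw [extZero_succ_iff] at *
  refine subsingleton_of_forall_eq 0 fun x => ?_
  obtain ⟨y, rfl⟩ := Abelian.Ext.covariant_sequence_exact₁ X hS x
    (hB.elim _ _) (n₀ := n + 1) rfl
  rw [hC.elim y 0, Abelian.Ext.zero_comp]

lemma ExtZero.of_ses_right {A B C X : ModuleCat.{u} R} {f : A ⟶ B} {g : B ⟶ C}
    (h : IsSES f g) {n : ℕ} (hA : ExtZero X A (n + 2)) (hB : ExtZero X B (n + 1)) :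
    ExtZero X C (n + 1) := by
  obtain ⟨w, hS⟩ := h
  rw [extZero_succ_iff] at *
  refine subsingleton_of_forall_eq 0 fun x => ?_
  obtain ⟨y, rfl⟩ := Abelian.Ext.covariant_sequence_exact₃ X hS x
    (n₁ := n + 2) rfl (hA.elim _ _)
  rw [hB.elim y 0, Abelian.Ext.zero_comp]

lemma extZero_succ_of_injective (X I : ModuleCat.{u} R) [Injective I] (n : ℕ) :
    ExtZero X I (n + 1) :=
  (extZero_succ_iff X I n).2 (Abelian.Ext.subsingleton_of_injective X I n)

lemma IsSES.exists_retraction {A B C : ModuleCat.{u} R} {f : A ⟶ B} {g : B ⟶ C}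
    (h : IsSES f g) (hExt : ExtZero C A 1) : ∃ r : B ⟶ A, f ≫ r = 𝟙 A := by
  obtain ⟨w, hS⟩ := h
  have hsub := (extZero_succ_iff C A 0).1 hExt
  obtain ⟨x, hx⟩ := Abelian.Ext.contravariant_sequence_exact₁ hS A
    (Abelian.Ext.mk₀ (𝟙 A)) (n₁ := 1) rfl (hsub.elim _ _)
  obtain ⟨r, rfl⟩ := (Abelian.Ext.mk₀_bijective _ _).2 x
  exact ⟨r, (Abelian.Ext.mk₀_bijective _ _).1 (by simpa using hx)⟩

lemma exists_isSES_injective (M : ModuleCat.{u} R) :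
    ∃ (I C : ModuleCat.{u} R) (f : M ⟶ I) (g : I ⟶ C), Injective I ∧ IsSES f g :=
  ⟨Injective.under M, cokernel (Injective.ι M), Injective.ι M, cokernel.π _, inferInstance,
    cokernel.condition _,
    { exact := ShortComplex.exact_of_g_is_cokernel _ (cokernelIsCokernel _) }⟩

lemma extZero_of_rid_lt {𝒳 : Set (ModuleCat.{u} R)} {X M : ModuleCat.{u} R} (hX : X ∈ 𝒳)
    {j : ℕ} (hj : rid 𝒳 M < j) : ExtZero X M j := by
  obtain ⟨n, hn, hnj⟩ := sInf_lt_iff.1 hj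
  exact hn j hnj X hX

lemma extZero_of_pd_lt {X M : ModuleCat.{u} R} {j : ℕ} (hj : pd X < j) : ExtZero X M j := by
  obtain ⟨n, hn, hnj⟩ := sInf_lt_iff.1 hj
  exact hn j hnj M trivial

lemma rid_le_pdClass (𝒳 : Set (ModuleCat.{u} R)) (M : ModuleCat.{u} R) :
    rid 𝒳 M ≤ pdClass 𝒳 :=
  sInf_le fun _ hj X hX =>
    extZero_of_pd_lt ((le_iSup (fun Y : 𝒳 => pd Y.1) ⟨X, hX⟩).trans_lt hj)

lemma extZero_of_ridClass_lt {𝒳 𝒴 : Set (ModuleCat.{u} R)} {X Y : ModuleCat.{u} R}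
    (hX : X ∈ 𝒳) (hY : Y ∈ 𝒴) {j : ℕ} (hj : ridClass 𝒳 𝒴 < j) : ExtZero X Y j :=
  extZero_of_rid_lt hX ((le_iSup (fun Y : 𝒴 => rid 𝒳 Y.1) ⟨Y, hY⟩).trans_lt hj)

lemma coresdim_le {𝒴 : Set (ModuleCat.{u} R)} {n : ℕ} {M : ModuleCat.{u} R}
    (h : HasCoresLen 𝒴 n M) : coresdim 𝒴 M ≤ n :=
  iInf_le (fun k : {k : ℕ // HasCoresLen 𝒴 k M} => ((k : ℕ) : ℕ∞)) ⟨n, h⟩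

lemma HasCoresLen.extZero {𝒳 𝒴 : Set (ModuleCat.{u} R)} {X : ModuleCat.{u} R} (hX : X ∈ 𝒳)
    {n : ℕ} {L : ModuleCat.{u} R} (hL : HasCoresLen 𝒴 n L) {j : ℕ}
    (hj : ridClass 𝒳 𝒴 + n < j) : ExtZero X L j := by
  induction n generalizing L j with
  | zero => exact extZero_of_ridClass_lt hX hL (by simpa using hj)
  | succ n ih =>
    obtain ⟨Y, C, f, g, hY, hfg, hC⟩ := hL
    obtain ⟨m, hm⟩ := ENat.ne_top_iff_exists.1
      (ne_top_of_le_ne_top (ENat.natCast_ne_top j) (le_self_add.trans hj.le))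
    rw [← hm] at hj
    norm_cast at hj
    obtain ⟨i, rfl⟩ : ∃ i, j = i + 2 := ⟨j - 2, by omega⟩
    refine ExtZero.of_ses_left hfg (extZero_of_ridClass_lt hX hY ?_) (ih hC ?_) <;>
    · rw [← hm]
      norm_cast
      omega

lemma rid_le_ridClass_add_coresdim (𝒳 𝒴 : Set (ModuleCat.{u} R)) (L : ModuleCat.{u} R) :
    rid 𝒳 L ≤ ridClass 𝒳 𝒴 + coresdim 𝒴 L := by
  rw [coresdim, ENat.add_iInf]
  exact le_iInf fun n => sInf_le fun _ hj _ hX => n.2.extZero hX hj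

lemma HasCoresLen.of_extZero_succ {𝒳 : Set (ModuleCat.{u} R)} {n : ℕ} {M : ModuleCat.{u} R}
    (h : ∀ X ∈ 𝒳, ExtZero X M (n + 1)) : HasCoresLen (rperp1 𝒳) n M := by
  induction n generalizing M with
  | zero => exact h
  | succ n ih =>
    obtain ⟨I, C, f, g, _, hfg⟩ := exists_isSES_injective M
    exact ⟨I, C, f, g, fun X _ => extZero_succ_of_injective X I 0, hfg,
      ih fun X hX => ExtZero.of_ses_right hfg (h X hX) (extZero_succ_of_injective X I n)⟩

lemma coresdim_rperp1_le_rid (𝒳 : Set (ModuleCat.{u} R)) (M : ModuleCat.{u} R) :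
    coresdim (rperp1 𝒳) M ≤ rid 𝒳 M := by
  rcases eq_or_ne (rid 𝒳 M) ⊤ with h | h
  · simp [h]
  obtain ⟨n, hn⟩ := ENat.ne_top_iff_exists.1 h
  rw [← hn]
  refine coresdim_le (.of_extZero_succ fun X hX => extZero_of_rid_lt hX ?_)
  rw [← hn]
  exact_mod_cast n.lt_succ_self

lemma HasCoresLen.of_succ {𝒳 𝒴 : Set (ModuleCat.{u} R)} (hsub : 𝒴 ⊆ 𝒳)
    (hsum : ClosedUnderSummands 𝒴) (hid : ridClass 𝒳 𝒴 = 0) {n : ℕ} {L : ModuleCat.{u} R}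
    (hL : HasCoresLen 𝒴 (n + 1) L) (h : ∀ X ∈ 𝒳, ExtZero X L (n + 1)) :
    HasCoresLen 𝒴 n L := by
  induction n generalizing L with
  | zero =>
    obtain ⟨Y, C, f, g, hY, hfg, hC⟩ := hL
    obtain ⟨r, hr⟩ := hfg.exists_retraction (h C (hsub hC))
    exact hsum L Y f r hr hY
  | succ n ih =>
    obtain ⟨Y, C, f, g, hY, hfg, hC⟩ := hL
    refine ⟨Y, C, f, g, hY, hfg, ih hC fun X hX => ExtZero.of_ses_right hfg (h X hX) ?_⟩
    exact extZero_of_ridClass_lt hX hY (by rw [hid]; exact_mod_cast n.succ_pos)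

lemma coresdim_le_rid_of_closedUnderSummands {𝒳 𝒴 : Set (ModuleCat.{u} R)} (hsub : 𝒴 ⊆ 𝒳)
    (hsum : ClosedUnderSummands 𝒴) (hid : ridClass 𝒳 𝒴 = 0) {L : ModuleCat.{u} R}
    (hL : L ∈ coresClosure 𝒴) : coresdim 𝒴 L ≤ rid 𝒳 L := by
  classical
  refine (coresdim_le (Nat.find_spec hL)).trans (le_of_not_gt fun hlt => ?_)
  obtain ⟨m, hm⟩ : ∃ m, Nat.find hL = m + 1 :=
    Nat.exists_eq_succ_of_ne_zero fun h0 => by simp [h0] at hlt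
  refine Nat.find_min hL (m := m) (by omega) (.of_succ hsub hsum hid (hm ▸ Nat.find_spec hL) ?_)
  exact fun X hX => extZero_of_rid_lt hX (hm ▸ hlt)

/-- Proposition 2.1: comparison of relative injective dimension and coresolution
dimension for arbitrary classes `𝒳`, `𝒴`. -/
theorem stmt19 {R : Type u} [Ring R] (𝒳 𝒴 : Set (ModuleCat.{u} R)) :
    (∀ L : ModuleCat.{u} R, rid 𝒳 L ≤ ridClass 𝒳 𝒴 + coresdim 𝒴 L) ∧
    ((𝒴 = rperp1 𝒳 ∨ (𝒴 ⊆ 𝒳 ∧ ClosedUnderSummands 𝒴)) → ridClass 𝒳 𝒴 = 0 →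
      ∀ L ∈ coresClosure 𝒴, rid 𝒳 L = coresdim 𝒴 L) ∧
    (𝒴 = rperp1 𝒳 →
      (∀ M : ModuleCat.{u} R, coresdim 𝒴 M ≤ rid 𝒳 M) ∧
      coresdimClass 𝒴 Set.univ ≤ pdClass 𝒳) := by
  refine ⟨rid_le_ridClass_add_coresdim 𝒳 𝒴, ?_, ?_⟩
  · intro h hid L hL
    refine le_antisymm (by simpa [hid] using rid_le_ridClass_add_coresdim 𝒳 𝒴 L) ?_
    rcases h with rfl | ⟨hsub, hsum⟩
    · exact coresdim_rperp1_le_rid 𝒳 L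
    · exact coresdim_le_rid_of_closedUnderSummands hsub hsum hid hL
  · rintro rfl
    exact ⟨coresdim_rperp1_le_rid 𝒳, iSup_le fun M =>
      (coresdim_rperp1_le_rid 𝒳 M.1).trans (rid_le_pdClass 𝒳 M.1)⟩


end CotorsionDim
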